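/- Let T¹ ∈ ℝ with T¹ ≠ 0, and consider on the half-plane U = {(x¹,x²) ∈ ℝ² : x¹ > 0} the Type B connection with Christoffel symbols Γ_{11}¹ = −(3/2)/x¹, Γ_{12}¹ = T¹/x¹, Γ_{12}² = −(1/2)/x¹, Γ_{21}¹ = −T¹/x¹, Γ_{21}² = −(1/2)/x¹, and all other Γ_{ij}^k = 0 (the model N₂⁶(−½;(T¹,0))). Then a smooth vector field X on U is an affine Killing vector field for this connection if and only if X lies in the ℝ-linear span of the three vector fields (x¹, x²), (0,1), and (2x¹x², (x²)²). -/

import Mathlib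

open Real

/-- The partial derivative `∂f/∂x^i` of a function on `ℝ²` (points are `Fin 2 → ℝ`). -/
noncomputable def pd (f : (Fin 2 → ℝ) → ℝ) (i : Fin 2) (p : Fin 2 → ℝ) : ℝ :=
  fderiv ℝ f p (Pi.single i 1)

/-- The affine Killing operator
`K^Γ_{ij}^k(v) = ∂_i∂_j v^k + v^l ∂_l Γ_{ij}^k − Γ_{ij}^l ∂_l v^k + Γ_{il}^k ∂_j v^l + Γ_{lj}^k ∂_i v^l`
(summation over `l`). -/
noncomputable def killingOp (Γ : Fin 2 → Fin 2 → Fin 2 → (Fin 2 → ℝ) → ℝ)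
    (v : Fin 2 → (Fin 2 → ℝ) → ℝ) (i j k : Fin 2) (p : Fin 2 → ℝ) : ℝ :=
  pd (fun q => pd (v k) j q) i p
    + (∑ l : Fin 2, v l p * pd (Γ i j k) l p)
    - (∑ l : Fin 2, Γ i j l p * pd (v k) l p)
    + (∑ l : Fin 2, Γ i l k p * pd (v l) j p)
    + (∑ l : Fin 2, Γ l j k p * pd (v l) i p)

/-- `v` is an affine Killing vector field for the connection `Γ` on `U`:
all eight affine Killing equations hold on `U`. -/
def IsAffineKilling (U : Set (Fin 2 → ℝ))
    (Γ : Fin 2 → Fin 2 → Fin 2 → (Fin 2 → ℝ) → ℝ)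
    (v : Fin 2 → (Fin 2 → ℝ) → ℝ) : Prop :=
  ∀ i j k : Fin 2, ∀ p ∈ U, killingOp Γ v i j k p = 0

lemma pd_congr {f g : (Fin 2 → ℝ) → ℝ} {U : Set (Fin 2 → ℝ)} (hU : IsOpen U)
    (h : ∀ q ∈ U, f q = g q) (i : Fin 2) {p : Fin 2 → ℝ} (hp : p ∈ U) :
    pd f i p = pd g i p := by
  have : f =ᶠ[nhds p] g := Filter.eventually_of_mem (hU.mem_nhds hp) h
  rw [pd, pd, this.fderiv_eq]

lemma pd_const (c : ℝ) (i : Fin 2) (p : Fin 2 → ℝ) : pd (fun _ => c) i p = 0 := by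
  simp [pd]

lemma pd_coord (m i : Fin 2) (p : Fin 2 → ℝ) :
    pd (fun q => q m) i p = (Pi.single i 1 : Fin 2 → ℝ) m := by
  have := (ContinuousLinearMap.proj (R := ℝ) (φ := fun _ : Fin 2 => ℝ) m).hasFDerivAt (x := p)
  have h : HasFDerivAt (fun q : Fin 2 → ℝ => q m) _ p := this
  rw [pd, h.fderiv]
  rfl

lemma pd_add {f g : (Fin 2 → ℝ) → ℝ} {p : Fin 2 → ℝ} (hf : DifferentiableAt ℝ f p)
    (hg : DifferentiableAt ℝ g p) (i : Fin 2) :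
    pd (fun q => f q + g q) i p = pd f i p + pd g i p := by
  simp [pd, fderiv_fun_add hf hg]

lemma pd_sub {f g : (Fin 2 → ℝ) → ℝ} {p : Fin 2 → ℝ} (hf : DifferentiableAt ℝ f p)
    (hg : DifferentiableAt ℝ g p) (i : Fin 2) :
    pd (fun q => f q - g q) i p = pd f i p - pd g i p := by
  simp [pd, fderiv_fun_sub hf hg]

lemma pd_mul {f g : (Fin 2 → ℝ) → ℝ} {p : Fin 2 → ℝ} (hf : DifferentiableAt ℝ f p)
    (hg : DifferentiableAt ℝ g p) (i : Fin 2) :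
    pd (fun q => f q * g q) i p = pd f i p * g p + f p * pd g i p := by
  simp [pd, fderiv_fun_mul hf hg]
  ring

lemma pd_div_coord_zero {f : (Fin 2 → ℝ) → ℝ} {p : Fin 2 → ℝ} (hf : DifferentiableAt ℝ f p)
    (hp : p 0 ≠ 0) (i : Fin 2) :
    pd (fun q => f q / q 0) i p
      = pd f i p / p 0 - f p * (Pi.single i 1 : Fin 2 → ℝ) 0 / p 0 ^ 2 := by
  have hd : DifferentiableAt ℝ (fun q : Fin 2 → ℝ => f q / q 0) p := by fun_prop (disch := exact hp)
  have hc : DifferentiableAt ℝ (fun q : Fin 2 → ℝ => q 0) p := by fun_prop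
  have h := pd_mul hd hc i
  have hU : IsOpen {q : Fin 2 → ℝ | q 0 ≠ 0} := isOpen_ne_fun (by fun_prop) (by fun_prop)
  rw [pd_congr (g := f) hU (fun q hq => div_mul_cancel₀ _ hq) i hp, pd_coord] at h
  rw [h]
  field_simp
  ring

lemma isOpen_halfPlane : IsOpen {p : Fin 2 → ℝ | 0 < p 0} :=
  isOpen_lt continuous_const (continuous_apply 0)

lemma convex_halfPlane : Convex ℝ {p : Fin 2 → ℝ | 0 < p 0} :=
  convex_halfSpace_gt ⟨fun _ _ => rfl, fun _ _ => rfl⟩ 0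

/-- A differentiable function on the half-plane with vanishing partial derivatives is constant. -/
lemma exists_eq_const_of_pd_eq_zero {f : (Fin 2 → ℝ) → ℝ}
    (hf : ∀ p ∈ {p : Fin 2 → ℝ | 0 < p 0}, DifferentiableAt ℝ f p)
    (h0 : ∀ p ∈ {p : Fin 2 → ℝ | 0 < p 0}, pd f 0 p = 0)
    (h1 : ∀ p ∈ {p : Fin 2 → ℝ | 0 < p 0}, pd f 1 p = 0) :
    ∃ c, ∀ p ∈ {p : Fin 2 → ℝ | 0 < p 0}, f p = c := by
  refine isOpen_halfPlane.exists_is_const_of_fderiv_eq_zero convex_halfPlane.isPreconnected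
    (fun p hp => (hf p hp).differentiableWithinAt) fun p hp => ?_
  refine ContinuousLinearMap.coe_injective (LinearMap.pi_ext' fun i => LinearMap.ext_ring ?_)
  fin_cases i
  · exact h0 p hp
  · exact h1 p hp

lemma pd_comm {f : (Fin 2 → ℝ) → ℝ} {p : Fin 2 → ℝ} (hf : ContDiffAt ℝ (⊤ : ℕ∞) f p)
    (i j : Fin 2) : pd (fun q => pd f j q) i p = pd (fun q => pd f i q) j p := by
  have hs : IsSymmSndFDerivAt ℝ f p :=
    hf.isSymmSndFDerivAt (by
      rw [minSmoothness_of_isRCLikeNormedField]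
      exact WithTop.coe_le_coe.2 le_top)
  have hd : DifferentiableAt ℝ (fderiv ℝ f) p :=
    (hf.fderiv_right (m := 1) (by norm_cast)).differentiableAt (by simp)
  have key : ∀ a b : Fin 2, pd (fun q => pd f a q) b p
      = fderiv ℝ (fderiv ℝ f) p (Pi.single b 1) (Pi.single a 1) := by
    intro a b
    unfold pd
    rw [fderiv_clm_apply hd (differentiableAt_const _)]
    simp
  rw [key, key, hs.eq]

lemma ContDiffAt.differentiableAt_pd {f : (Fin 2 → ℝ) → ℝ} {p : Fin 2 → ℝ}
    (hf : ContDiffAt ℝ (⊤ : ℕ∞) f p) (i : Fin 2) :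
    DifferentiableAt ℝ (fun q => pd f i q) p := by
  have hd : DifferentiableAt ℝ (fderiv ℝ f) p :=
    (hf.fderiv_right (m := 1) (by norm_cast)).differentiableAt (by simp)
  unfold pd
  fun_prop

/-- The first-order system `∂₁w = 0`, `x¹∂₂w = u`, `x¹∂₁u = u`, `∂₂∂₂u = 0`
has only the expected solutions. -/
lemma exists_coeffs_of_system {u w : (Fin 2 → ℝ) → ℝ}
    (hu : ∀ p ∈ {p : Fin 2 → ℝ | 0 < p 0}, ContDiffAt ℝ (⊤ : ℕ∞) u p)
    (hw : ∀ p ∈ {p : Fin 2 → ℝ | 0 < p 0}, ContDiffAt ℝ (⊤ : ℕ∞) w p)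
    (hw0 : ∀ p ∈ {p : Fin 2 → ℝ | 0 < p 0}, pd w 0 p = 0)
    (hw1 : ∀ p ∈ {p : Fin 2 → ℝ | 0 < p 0}, p 0 * pd w 1 p = u p)
    (hu0 : ∀ p ∈ {p : Fin 2 → ℝ | 0 < p 0}, p 0 * pd u 0 p = u p)
    (hu10 : ∀ p ∈ {p : Fin 2 → ℝ | 0 < p 0}, p 0 * pd (fun q => pd u 1 q) 0 p = pd u 1 p)
    (hu11 : ∀ p ∈ {p : Fin 2 → ℝ | 0 < p 0}, pd (fun q => pd u 1 q) 1 p = 0) :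
    ∃ a b c : ℝ, ∀ p ∈ {p : Fin 2 → ℝ | 0 < p 0},
      u p = a * p 0 + c * (2 * p 0 * p 1) ∧ w p = a * p 1 + b + c * (p 1) ^ 2 := by
  have hne : ∀ p ∈ {p : Fin 2 → ℝ | 0 < p 0}, p 0 ≠ 0 := fun p hp => ne_of_gt hp
  have hud : ∀ p ∈ {p : Fin 2 → ℝ | 0 < p 0}, DifferentiableAt ℝ u p := fun p hp =>
    (hu p hp).differentiableAt (by simp)
  have hwd : ∀ p ∈ {p : Fin 2 → ℝ | 0 < p 0}, DifferentiableAt ℝ w p := fun p hp =>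
    (hw p hp).differentiableAt (by simp)
  obtain ⟨k, hk⟩ : ∃ k, ∀ p ∈ {p : Fin 2 → ℝ | 0 < p 0}, pd u 1 p / p 0 = k := by
    have hd := fun p hp => (hu p hp).differentiableAt_pd 1
    refine exists_eq_const_of_pd_eq_zero (fun p hp => ?_) (fun p hp => ?_) (fun p hp => ?_)
    · have := hd p hp
      fun_prop (disch := exact hne p hp)
    · have := hne p hp
      rw [pd_div_coord_zero (hd p hp) this, ← hu10 p hp]
      simp
      field_simp
      ring
    · rw [pd_div_coord_zero (hd p hp) (hne p hp), hu11 p hp]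
      simp
  obtain ⟨a, ha⟩ : ∃ a, ∀ p ∈ {p : Fin 2 → ℝ | 0 < p 0}, u p / p 0 - k * p 1 = a := by
    have hd : ∀ p ∈ {p : Fin 2 → ℝ | 0 < p 0}, DifferentiableAt ℝ (fun q => u q / q 0) p := by
      intro p hp
      have := hud p hp
      fun_prop (disch := exact hne p hp)
    have hpd : ∀ i, ∀ p ∈ {p : Fin 2 → ℝ | 0 < p 0}, pd (fun q => u q / q 0 - k * q 1) i p
        = pd u i p / p 0 - u p * (Pi.single i 1 : Fin 2 → ℝ) 0 / p 0 ^ 2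
          - k * (Pi.single i 1 : Fin 2 → ℝ) 1 := by
      intro i p hp
      rw [pd_sub (hd p hp) (by fun_prop), pd_div_coord_zero (hud p hp) (hne p hp),
        pd_mul (by fun_prop) (by fun_prop), pd_const, pd_coord]
      ring
    refine exists_eq_const_of_pd_eq_zero (fun p hp => ?_) (fun p hp => ?_) (fun p hp => ?_)
    · have := hd p hp
      fun_prop
    · have := hne p hp
      rw [hpd 0 p hp, ← hu0 p hp]
      simp
      field_simp
      ring
    · rw [hpd 1 p hp, hk p hp]
      simp
  have hu_eq : ∀ p ∈ {p : Fin 2 → ℝ | 0 < p 0}, u p = (a + k * p 1) * p 0 := by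
    intro p hp
    have := hne p hp
    rw [← ha p hp]
    field_simp
    ring
  obtain ⟨b, hb⟩ : ∃ b, ∀ p ∈ {p : Fin 2 → ℝ | 0 < p 0},
      w p - (a * p 1 + k / 2 * (p 1 * p 1)) = b := by
    have hpd : ∀ i, ∀ p ∈ {p : Fin 2 → ℝ | 0 < p 0},
        pd (fun q => w q - (a * q 1 + k / 2 * (q 1 * q 1))) i p
        = pd w i p - (a + k * p 1) * (Pi.single i 1 : Fin 2 → ℝ) 1 := by
      intro i p hp
      rw [pd_sub (hwd p hp) (by fun_prop), pd_add (by fun_prop) (by fun_prop),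
        pd_mul (by fun_prop) (by fun_prop), pd_mul (by fun_prop) (by fun_prop),
        pd_mul (by fun_prop) (by fun_prop), pd_const, pd_const, pd_coord]
      ring
    refine exists_eq_const_of_pd_eq_zero (fun p hp => ?_) (fun p hp => ?_) (fun p hp => ?_)
    · have := hwd p hp
      fun_prop
    · rw [hpd 0 p hp, hw0 p hp]
      simp
    · have h := hw1 p hp
      rw [hu_eq p hp, mul_comm, mul_left_inj' (hne p hp)] at h
      rw [hpd 1 p hp, h]
      simp
  refine ⟨a, b, k / 2, fun p hp => ⟨?_, ?_⟩⟩
  · rw [hu_eq p hp]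
    ring
  · rw [← hb p hp]
    ring

theorem stmt16 (T1 : ℝ) (hT : T1 ≠ 0)
    (v : Fin 2 → (Fin 2 → ℝ) → ℝ)
    (hv : ∀ i : Fin 2, ContDiffOn ℝ (⊤ : ℕ∞) (v i) {p : Fin 2 → ℝ | 0 < p 0}) :
    IsAffineKilling {p : Fin 2 → ℝ | 0 < p 0}
      (fun i j k => fun p : Fin 2 → ℝ =>
        ![![![(-(3 / 2) : ℝ), 0], ![T1, -(1 / 2)]],
          ![![-T1, -(1 / 2)], ![0, 0]]] i j k / p 0) v
    ↔ ∃ a b c : ℝ, ∀ p ∈ {p : Fin 2 → ℝ | 0 < p 0},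
        v 0 p = a * p 0 + c * (2 * p 0 * p 1)
        ∧ v 1 p = a * p 1 + b + c * (p 1) ^ 2 := by
  have hsm : ∀ i, ∀ p ∈ {p : Fin 2 → ℝ | 0 < p 0}, ContDiffAt ℝ (⊤ : ℕ∞) (v i) p :=
    fun i p hp => (hv i).contDiffAt (isOpen_halfPlane.mem_nhds hp)
  have hΓ : ∀ c : ℝ, ∀ i, ∀ p ∈ {p : Fin 2 → ℝ | 0 < p 0},
      pd (fun q => c / q 0) i p = -(c * (Pi.single i 1 : Fin 2 → ℝ) 0 / p 0 ^ 2) := by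
    intro c i p hp
    rw [pd_div_coord_zero (differentiableAt_const c) (ne_of_gt hp), pd_const]
    ring
  constructor
  · intro hK
    have E : ∀ p ∈ {p : Fin 2 → ℝ | 0 < p 0},
        pd (v 1) 0 p = 0 ∧ p 0 * pd (v 1) 1 p = v 0 p ∧
        p 0 * pd (fun q => pd (v 0) 1 q) 0 p = pd (v 0) 1 p ∧
        pd (fun q => pd (v 0) 1 q) 1 p = 0 := by
      intro p hp
      have hne : p 0 ≠ 0 := ne_of_gt hp
      have e120 := hK 0 1 0 p hp
      have e210 := hK 1 0 0 p hp
      have e121 := hK 0 1 1 p hp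
      have e211 := hK 1 0 1 p hp
      have e220 := hK 1 1 0 p hp
      simp only [killingOp, Fin.sum_univ_two, hΓ _ _ p hp] at e120 e210 e121 e211 e220
      rw [pd_comm (hsm _ p hp)] at e210 e211
      simp at e120 e210 e121 e211 e220
      field_simp at e120 e210 e121 e211 e220
      refine ⟨?_, ?_, ?_, ?_⟩
      · refine (mul_eq_zero.mp (?_ : T1 * p 0 * pd (v 1) 0 p = 0)).resolve_left
          (mul_ne_zero hT hne)
        linarith
      · refine mul_left_cancel₀ hT ?_
        linarith
      · refine mul_left_cancel₀ hne ?_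
        linarith
      · refine mul_left_cancel₀ hne ?_
        linarith
    have hmix : ∀ p ∈ {p : Fin 2 → ℝ | 0 < p 0}, pd (fun q => pd (v 1) 1 q) 0 p = 0 := by
      intro p hp
      rw [pd_comm (hsm 1 p hp), pd_congr isOpen_halfPlane (fun q hq => (E q hq).1) 1 hp, pd_const]
    refine exists_coeffs_of_system (hsm 0) (hsm 1) (fun p hp => (E p hp).1)
      (fun p hp => (E p hp).2.1) (fun p hp => ?_) (fun p hp => (E p hp).2.2.1)
      (fun p hp => (E p hp).2.2.2)
    have hne : p 0 ≠ 0 := ne_of_gt hp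
    have e := hK 0 1 1 p hp
    simp only [killingOp, Fin.sum_univ_two, hΓ _ _ p hp, hmix p hp, (E p hp).1] at e
    simp at e
    field_simp at e
    linarith
  · rintro ⟨a, b, c, h⟩ i j k p hp
    have hne : p 0 ≠ 0 := ne_of_gt hp
    have d0 : ∀ j, ∀ q ∈ {p : Fin 2 → ℝ | 0 < p 0}, pd (v 0) j q
        = (a + 2 * c * q 1) * (Pi.single j 1 : Fin 2 → ℝ) 0
          + 2 * c * q 0 * (Pi.single j 1 : Fin 2 → ℝ) 1 := by
      intro j q hq
      rw [pd_congr (g := fun q => (a + 2 * c * q 1) * q 0) isOpen_halfPlane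
        (fun r hr => by rw [(h r hr).1]; ring) j hq, pd_mul (by fun_prop) (by fun_prop),
        pd_add (by fun_prop) (by fun_prop), pd_mul (by fun_prop) (by fun_prop), pd_const,
        pd_const, pd_coord, pd_coord]
      ring
    have d1 : ∀ j, ∀ q ∈ {p : Fin 2 → ℝ | 0 < p 0}, pd (v 1) j q
        = (a + 2 * c * q 1) * (Pi.single j 1 : Fin 2 → ℝ) 1 := by
      intro j q hq
      rw [pd_congr (g := fun q => (a + c * q 1) * q 1 + b) isOpen_halfPlane
        (fun r hr => by rw [(h r hr).2]; ring) j hq, pd_add (by fun_prop) (by fun_prop),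
        pd_mul (by fun_prop) (by fun_prop),
        pd_add (by fun_prop) (by fun_prop), pd_mul (by fun_prop) (by fun_prop), pd_const,
        pd_const, pd_const, pd_coord]
      ring
    have dd0 : ∀ i j, pd (fun q => pd (v 0) j q) i p
        = 2 * c * (Pi.single i 1 : Fin 2 → ℝ) 1 * (Pi.single j 1 : Fin 2 → ℝ) 0
          + 2 * c * (Pi.single i 1 : Fin 2 → ℝ) 0 * (Pi.single j 1 : Fin 2 → ℝ) 1 := by
      intro i j
      rw [pd_congr isOpen_halfPlane (d0 j) i hp, pd_add (by fun_prop) (by fun_prop),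
        pd_mul (by fun_prop) (by fun_prop), pd_mul (by fun_prop) (by fun_prop),
        pd_add (by fun_prop) (by fun_prop), pd_mul (by fun_prop) (by fun_prop),
        pd_mul (by fun_prop) (by fun_prop), pd_mul (by fun_prop) (by fun_prop)]
      simp only [pd_const, pd_coord]
      ring
    have dd1 : ∀ i j, pd (fun q => pd (v 1) j q) i p
        = 2 * c * (Pi.single i 1 : Fin 2 → ℝ) 1 * (Pi.single j 1 : Fin 2 → ℝ) 1 := by
      intro i j
      rw [pd_congr isOpen_halfPlane (d1 j) i hp, pd_mul (by fun_prop) (by fun_prop),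
        pd_add (by fun_prop) (by fun_prop), pd_mul (by fun_prop) (by fun_prop)]
      simp only [pd_const, pd_coord]
      ring
    have hk : ∀ k : Fin 2, k = 0 ∨ k = 1 := by decide
    rcases hk i with rfl | rfl <;> rcases hk j with rfl | rfl <;> rcases hk k with rfl | rfl <;>
    · simp only [killingOp, Fin.sum_univ_two, hΓ _ _ p hp, dd0, dd1, d0 _ p hp, d1 _ p hp,
        (h p hp).1]
      simp
      try field_simp
      try ring
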